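/- arXiv:1202.0813 — 5 statements merged into one kernel-verified Lean document; each statement's English description precedes it below -/
import Mathlib

section
/- For every ρ ∈ [0,1], if M − 1 ≤ e^{NR}, then the probability of maximum-likelihood decoding failure (with ties counted as errors) satisfies P_e ≤ exp(−N(E_{0,N}(ρ,Q,s) − ρR)), where E_{0,N}(ρ,Q,s) = −(1/N) ln ∏_{n=1}^N ∑_{y∈Y} [∑_{x∈X} Q(x) P(y|x,s_n)^{1/(1+ρ)}]^{1+ρ}. -/
open scoped Classical
open Finset

/-- The marginal of a product distribution: the weighted average of a function of one coordinate. -/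
theorem sum_pi_prod_mul_apply {A : Type*} [Fintype A] {k : ℕ} (q f : A → ℝ)
    (hq : ∑ a, q a = 1) (j : Fin k) :
    ∑ c : Fin k → A, (∏ i, q (c i)) * f (c j) = ∑ a, q a * f a := by
  have h (c : Fin k → A) :
      (∏ i, q (c i)) * f (c j) = ∏ i, q (c i) * (if i = j then f (c i) else 1) := by
    rw [Finset.prod_mul_distrib, Finset.prod_ite_eq' Finset.univ j (fun i => f (c i))]
    simp
  simp_rw [h]
  rw [← Fintype.prod_sum (fun (i : Fin k) a => q a * (if i = j then f a else 1))]
  rw [Finset.prod_eq_single j]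
  · simp
  · intro i _ hi
    simp [hi, hq]
  · simp

theorem sum_pi_prod_eq_one {A : Type*} [Fintype A] {k : ℕ} (q : A → ℝ)
    (hq : ∑ a, q a = 1) : ∑ c : Fin k → A, ∏ i, q (c i) = 1 := by
  rw [← Fintype.prod_sum (fun (_ : Fin k) a => q a)]
  simp [hq]

/-- Gallager's form of the union bound for i.i.d. draws. -/
theorem sum_pi_prod_mul_exists_le_rpow {A : Type*} [Fintype A] {k : ℕ} (q : A → ℝ)
    (hq0 : ∀ a, 0 ≤ q a) (hq : ∑ a, q a = 1) (G : A → Prop) {ρ : ℝ} (hρ0 : 0 ≤ ρ)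
    (hρ1 : ρ ≤ 1) :
    ∑ c : Fin k → A, (∏ i, q (c i)) * (if ∃ i, G (c i) then 1 else 0) ≤
      ((k : ℝ) * ∑ a, q a * (if G a then 1 else 0)) ^ ρ := by
  have hprod (c : Fin k → A) : 0 ≤ ∏ i, q (c i) := Finset.prod_nonneg fun i _ => hq0 _
  have hle1 : ∑ c : Fin k → A, (∏ i, q (c i)) * (if ∃ i, G (c i) then 1 else 0) ≤ 1 := by
    refine (Finset.sum_le_sum fun c _ => mul_le_of_le_one_right (hprod c) ?_).trans_eq
      (sum_pi_prod_eq_one q hq)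
    split_ifs <;> norm_num
  have hunion : ∑ c : Fin k → A, (∏ i, q (c i)) * (if ∃ i, G (c i) then 1 else 0) ≤
      (k : ℝ) * ∑ a, q a * (if G a then 1 else 0) := by
    calc _ ≤ ∑ c : Fin k → A, ∑ j, (∏ i, q (c i)) * (if G (c j) then 1 else 0) := by
          refine Finset.sum_le_sum fun c _ => ?_
          rw [← Finset.mul_sum]
          refine mul_le_mul_of_nonneg_left ?_ (hprod c)
          have hnn : ∀ j ∈ Finset.univ, (0 : ℝ) ≤ if G (c j) then 1 else 0 := by
            intro j _
            split_ifs <;> norm_num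
          split_ifs with h
          · obtain ⟨j, hj⟩ := h
            simpa [hj] using Finset.single_le_sum hnn (Finset.mem_univ j)
          · exact Finset.sum_nonneg hnn
      _ = _ := by
          rw [Finset.sum_comm]
          simp_rw [sum_pi_prod_mul_apply q (fun a => if G a then (1 : ℝ) else 0) hq]
          simp
  have hnn : 0 ≤ (k : ℝ) * ∑ a, q a * (if G a then 1 else 0) := by
    refine mul_nonneg (Nat.cast_nonneg k) (Finset.sum_nonneg fun a _ => mul_nonneg (hq0 a) ?_)
    split_ifs <;> norm_num
  rcases le_total ((k : ℝ) * ∑ a, q a * (if G a then 1 else 0)) 1 with h | h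
  · exact hunion.trans (Real.self_le_rpow_of_le_one hnn h hρ1)
  · exact hle1.trans (Real.one_le_rpow h hρ0)

/-- Conditional error bound given the sent codeword `a`, weighted by the likelihood `p a`. -/
theorem likelihood_mul_rpow_le {A : Type*} [Fintype A] (q p : A → ℝ)
    (hq0 : ∀ a, 0 ≤ q a) (hp0 : ∀ a, 0 ≤ p a) {K ρ : ℝ} (hK : 0 ≤ K) (hρ0 : 0 ≤ ρ) (a : A) :
    p a * (K * ∑ b, q b * (if p a ≤ p b then 1 else 0)) ^ ρ ≤
      K ^ ρ * (p a ^ (1 / (1 + ρ)) * (∑ b, q b * p b ^ (1 / (1 + ρ))) ^ ρ) := by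
  have hρ : 0 < 1 + ρ := by linarith
  have ht : 0 < 1 / (1 + ρ) := by positivity
  have hW : 0 ≤ ∑ b, q b * p b ^ (1 / (1 + ρ)) :=
    Finset.sum_nonneg fun b _ => mul_nonneg (hq0 b) (Real.rpow_nonneg (hp0 b) _)
  rcases (hp0 a).eq_or_lt with h0 | hpos
  · rw [← h0, zero_mul]
    positivity
  set t := 1 / (1 + ρ) with htdef
  have hpt : 0 < p a ^ t := Real.rpow_pos_of_pos hpos t
  have hI0 : 0 ≤ ∑ b, q b * (if p a ≤ p b then (1 : ℝ) else 0) := by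
    refine Finset.sum_nonneg fun b _ => mul_nonneg (hq0 b) ?_
    split_ifs <;> norm_num
  have hI : ∑ b, q b * (if p a ≤ p b then (1 : ℝ) else 0) ≤
      (∑ b, q b * p b ^ t) / p a ^ t := by
    rw [Finset.sum_div]
    refine Finset.sum_le_sum fun b _ => ?_
    rw [mul_div_assoc]
    refine mul_le_mul_of_nonneg_left ?_ (hq0 b)
    split_ifs with h
    · rw [one_le_div hpt]
      exact Real.rpow_le_rpow hpos.le h ht.le
    · exact div_nonneg (Real.rpow_nonneg (hp0 b) _) hpt.le
  have hpa : p a = p a ^ t * (p a ^ t) ^ ρ := by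
    rw [← Real.rpow_mul hpos.le, ← Real.rpow_add hpos]
    have : t + t * ρ = 1 := by rw [htdef]; field_simp
    rw [this, Real.rpow_one]
  calc _ ≤ p a * (K * ((∑ b, q b * p b ^ t) / p a ^ t)) ^ ρ := by gcongr
    _ = _ := by
      rw [Real.mul_rpow hK (by positivity), Real.div_rpow hW hpt.le]
      have : 0 < (p a ^ t) ^ ρ := Real.rpow_pos_of_pos hpt ρ
      nth_rewrite 1 [hpa]
      field_simp

/-- Gallager's random-coding bound for a one-shot channel `p` on finite alphabets and `k + 1`
independent codewords drawn from `q`. -/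
theorem random_coding_bound {A B : Type*} [Fintype A] [Fintype B] (k : ℕ) (q : A → ℝ)
    (hq0 : ∀ a, 0 ≤ q a) (hq : ∑ a, q a = 1) (p : B → A → ℝ) (hp0 : ∀ y a, 0 ≤ p y a)
    {ρ : ℝ} (hρ0 : 0 ≤ ρ) (hρ1 : ρ ≤ 1) :
    ∑ cb : Fin (k + 1) → A, ∑ y, (∏ i, q (cb i)) * p y (cb 0) *
        (if ∃ i, i ≠ 0 ∧ p y (cb 0) ≤ p y (cb i) then 1 else 0) ≤
      (k : ℝ) ^ ρ * ∑ y, (∑ a, q a * p y a ^ (1 / (1 + ρ))) ^ (1 + ρ) := by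
  have hρ : 0 < 1 + ρ := by linarith
  rw [Finset.sum_comm, Finset.mul_sum]
  refine Finset.sum_le_sum fun y _ => ?_
  rw [← (Fin.consEquiv fun _ : Fin (k + 1) => A).sum_comp, Fintype.sum_prod_type]
  have hW : 0 ≤ ∑ b, q b * p y b ^ (1 / (1 + ρ)) :=
    Finset.sum_nonneg fun b _ => mul_nonneg (hq0 b) (Real.rpow_nonneg (hp0 y b) _)
  calc _ = ∑ a, q a * (p y a * ∑ c : Fin k → A, (∏ i, q (c i)) *
          (if ∃ i, p y a ≤ p y (c i) then 1 else 0)) := by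
        refine Finset.sum_congr rfl fun a _ => ?_
        rw [Finset.mul_sum, Finset.mul_sum]
        refine Finset.sum_congr rfl fun c _ => ?_
        simp only [Fin.consEquiv_apply, Fin.prod_univ_succ, Fin.cons_zero, Fin.cons_succ,
          Fin.exists_fin_succ, ne_eq, not_true_eq_false, false_and, false_or, Fin.succ_ne_zero,
          not_false_eq_true, true_and]
        ring
    _ ≤ ∑ a, q a * ((k : ℝ) ^ ρ * (p y a ^ (1 / (1 + ρ)) *
          (∑ b, q b * p y b ^ (1 / (1 + ρ))) ^ ρ)) := by
        refine Finset.sum_le_sum fun a _ => mul_le_mul_of_nonneg_left ?_ (hq0 a)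
        exact (mul_le_mul_of_nonneg_left
          (sum_pi_prod_mul_exists_le_rpow q hq0 hq (fun b => p y a ≤ p y b) hρ0 hρ1)
          (hp0 y a)).trans
            (likelihood_mul_rpow_le q (p y) hq0 (hp0 y) (Nat.cast_nonneg k) hρ0 a)
    _ = _ := by
        rw [Real.rpow_add_of_nonneg hW zero_le_one hρ0, Real.rpow_one, Finset.sum_mul,
          Finset.mul_sum]
        exact Finset.sum_congr rfl fun a _ => by ring

/-- For a product channel and a product input distribution, Gallager's function is a product. -/
theorem gallager_function_prod {X Y : Type*} [Fintype X] [Fintype Y] {N : ℕ} (Q : X → ℝ)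
    (hQ0 : ∀ x, 0 ≤ Q x) (W : Fin N → Y → X → ℝ) (hW0 : ∀ n y x, 0 ≤ W n y x) (t r : ℝ) :
    ∑ y : Fin N → Y, (∑ a : Fin N → X, (∏ n, Q (a n)) * (∏ n, W n (y n) (a n)) ^ t) ^ r =
      ∏ n, ∑ y, (∑ x, Q x * W n y x ^ t) ^ r := by
  rw [Fintype.prod_sum (fun n y => (∑ x, Q x * W n y x ^ t) ^ r)]
  refine Finset.sum_congr rfl fun y _ => ?_
  rw [Real.finsetProd_rpow _ _ fun n _ => Finset.sum_nonneg fun x _ =>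
    mul_nonneg (hQ0 x) (Real.rpow_nonneg (hW0 n (y n) x) _)]
  rw [Fintype.prod_sum (fun n x => Q x * W n (y n) x ^ t)]
  congr 1
  refine Finset.sum_congr rfl fun a _ => ?_
  rw [Finset.prod_mul_distrib, Real.finsetProd_rpow _ _ fun n _ => hW0 n (y n) (a n)]

theorem gallager_function_pos {X Y : Type*} [Fintype X] [Fintype Y] (Q : X → ℝ)
    (hQ0 : ∀ x, 0 ≤ Q x) (hQ1 : ∑ x, Q x = 1) (W : Y → X → ℝ) (hW0 : ∀ y x, 0 ≤ W y x)
    (hW1 : ∀ x, ∑ y, W y x = 1) (t r : ℝ) :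
    0 < ∑ y, (∑ x, Q x * W y x ^ t) ^ r := by
  have hnn (y : Y) (x : X) : 0 ≤ Q x * W y x ^ t :=
    mul_nonneg (hQ0 x) (Real.rpow_nonneg (hW0 y x) t)
  obtain ⟨x, -, hx⟩ : ∃ x ∈ Finset.univ, 0 < Q x :=
    (Finset.sum_pos_iff_of_nonneg fun x _ => hQ0 x).1 (by rw [hQ1]; exact one_pos)
  obtain ⟨y, -, hy⟩ : ∃ y ∈ Finset.univ, 0 < W y x :=
    (Finset.sum_pos_iff_of_nonneg fun y _ => hW0 y x).1 (by rw [hW1]; exact one_pos)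
  refine Finset.sum_pos' (fun y _ => Real.rpow_nonneg (Finset.sum_nonneg fun x _ => hnn y x) r)
    ⟨y, Finset.mem_univ y, Real.rpow_pos_of_pos ?_ r⟩
  exact Finset.sum_pos' (fun x _ => hnn y x)
    ⟨x, Finset.mem_univ x, mul_pos hx (Real.rpow_pos_of_pos hy t)⟩

/-- Gallager's random-coding bound for a finite-state channel with a
fixed state sequence `s`, in terms of the exponent `E_{0,N}(ρ,Q,s)`.  The codebook
consists of `M` independent codewords with product distribution `Q_N`; message `0`
is sent, the output is generated by `P_N(y|x) = ∏ₙ P(yₙ|xₙ,sₙ)`, and a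
maximum-likelihood decoding failure (ties counted as errors) occurs when some other
codeword is at least as likely as codeword `0`. -/
theorem stmt_0 {X Y S : Type*} [Fintype X] [Fintype Y] [Fintype S]
    (N M : ℕ) (hN : 1 ≤ N) (hM : 2 ≤ M)
    (Q : X → ℝ) (hQ0 : ∀ x, 0 ≤ Q x) (hQ1 : ∑ x, Q x = 1)
    (P : Y → X → S → ℝ) (hP0 : ∀ y x s, 0 ≤ P y x s)
    (hP1 : ∀ x s, ∑ y, P y x s = 1)
    (s : Fin N → S) (ρ R : ℝ) (hρ0 : 0 ≤ ρ) (hρ1 : ρ ≤ 1)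
    (hMR : (M : ℝ) - 1 ≤ Real.exp (N * R)) :
    (∑ cb : Fin M → Fin N → X, ∑ y : Fin N → Y,
        (∏ i, ∏ n, Q (cb i n)) * (∏ n, P (y n) (cb ⟨0, by omega⟩ n) (s n)) *
          (if ∃ i : Fin M, i ≠ ⟨0, by omega⟩ ∧
              (∏ n, P (y n) (cb ⟨0, by omega⟩ n) (s n)) ≤ ∏ n, P (y n) (cb i n) (s n)
            then 1 else 0))
      ≤ Real.exp (-(N : ℝ) *
          ((-(1 / (N : ℝ)) * Real.log (∏ n : Fin N, ∑ y : Y,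
              (∑ x : X, Q x * P y x (s n) ^ (1 / (1 + ρ))) ^ (1 + ρ))) - ρ * R)) := by
  obtain ⟨k, rfl⟩ : ∃ k, M = k + 1 := ⟨M - 1, by omega⟩
  have hbound := random_coding_bound k (fun a : Fin N → X => ∏ n, Q (a n))
    (fun a => Finset.prod_nonneg fun n _ => hQ0 (a n)) (sum_pi_prod_eq_one Q hQ1)
    (fun (y : Fin N → Y) a => ∏ n, P (y n) (a n) (s n))
    (fun y a => Finset.prod_nonneg fun n _ => hP0 (y n) (a n) (s n)) hρ0 hρ1
  rw [gallager_function_prod Q hQ0 (fun n y x => P y x (s n))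
    (fun n y x => hP0 y x (s n))] at hbound
  have hF : 0 < ∏ n : Fin N, ∑ y : Y,
      (∑ x : X, Q x * P y x (s n) ^ (1 / (1 + ρ))) ^ (1 + ρ) :=
    Finset.prod_pos fun n _ => gallager_function_pos Q hQ0 hQ1 (fun y x => P y x (s n))
      (fun y x => hP0 y x (s n)) (fun x => hP1 x (s n)) _ _
  have hk : (k : ℝ) ^ ρ ≤ Real.exp (N * R * ρ) := by
    rw [Real.exp_mul]
    exact Real.rpow_le_rpow (Nat.cast_nonneg k) (by simpa using hMR) hρ0
  have hN0 : (N : ℝ) ≠ 0 := by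
    have : N ≠ 0 := by omega
    exact_mod_cast this
  have hexp (L : ℝ) : -(N : ℝ) * (-(1 / (N : ℝ)) * L - ρ * R) = N * R * ρ + L := by
    field_simp
    ring
  rw [hexp, Real.exp_add, Real.exp_log hF]
  refine le_trans (le_of_eq ?_) (hbound.trans (mul_le_mul_of_nonneg_right hk hF.le))
  rfl
end

section
/- For every integer m with 0 < m < N: (i) Pr(n_g = m, s_N = g | s_0 = g) = (1−α)^m (1−β)^{N−m} [F(−N+m,−m;1;λ) − F(−N+m+1,−m;1;λ)], and (ii) Pr(n_g = m, s_N = b | s_0 = g) = (1−α)^{m−1} (1−β)^{N−m+1} (α/(1−β)) F(−N+m,−m+1;1;λ). Moreover, Pr(n_g = 0, s_N = d | s_0 = g) = 0 for d ∈ {g,b}, and Pr(n_g = N, s_N = g | s_0 = g) = (1−α)^N. -/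
open scoped Classical
open Finset

/-- One step of the two-state Gilbert-Elliott Markov chain on `Bool`, where `true`
is the good state `g` and `false` is the bad state `b`:
`P(b|g) = a`, `P(g|g) = 1−a`, `P(g|b) = b`, `P(b|b) = 1−b`. -/
noncomputable def geStep (a b : ℝ) (c d : Bool) : ℝ :=
  if c then (if d then 1 - a else a) else (if d then b else 1 - b)

/-- Probability of the trajectory `(t 0, t 1, …, t N)` given its initial state:
`∏_{n=0}^{N-1} P(t (n+1) | t n)`. -/
noncomputable def geTrajProb (a b : ℝ) (N : ℕ) (t : Fin (N + 1) → Bool) : ℝ :=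
  ∏ n : Fin N, geStep a b (t n.castSucc) (t n.succ)

/-- `Pr(n_g = m, s_N = d | s_0 = c)`: the sum of trajectory probabilities over all
trajectories `(s_0, …, s_N)` with `s_0 = c`, `s_N = d`, and exactly `m` indices
`n ∈ {0, …, N−1}` with `s_n = g` (`g = true`). -/
noncomputable def prOcc (a b : ℝ) (N m : ℕ) (c d : Bool) : ℝ :=
  ∑ t : Fin (N + 1) → Bool,
    if t 0 = c ∧ t (Fin.last N) = d ∧
        (Finset.univ.filter fun n : Fin N => t n.castSucc = true).card = m
      then geTrajProb a b N t else 0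

/-- The terminating Gauss hypergeometric series
`F(−a, −b; 1; λ) = ∑_{k ≥ 0} C(a,k) C(b,k) λ^k`. -/
noncomputable def hypF (a b : ℕ) (l : ℝ) : ℝ :=
  ∑ k ∈ Finset.range (a + 1), (a.choose k : ℝ) * (b.choose k : ℝ) * l ^ k

theorem geTrajProb_snoc (a b : ℝ) (N : ℕ) (t : Fin (N + 1) → Bool) (d : Bool) :
    geTrajProb a b (N + 1) (Fin.snoc t d : Fin (N + 2) → Bool) =
      geTrajProb a b N t * geStep a b (t (Fin.last N)) d := by
  unfold geTrajProb
  rw [Fin.prod_univ_castSucc]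
  simp only [Fin.succ_castSucc, Fin.snoc_castSucc, Fin.succ_last, Fin.snoc_last]

theorem card_filter_snoc (N : ℕ) (t : Fin (N + 1) → Bool) (d : Bool) :
    (univ.filter fun n : Fin (N + 1) =>
        (Fin.snoc t d : Fin (N + 2) → Bool) n.castSucc = true).card =
      (univ.filter fun n : Fin N => t n.castSucc = true).card +
        if t (Fin.last N) = true then 1 else 0 := by
  simp only [card_filter, Fin.snoc_castSucc]
  rw [Fin.sum_univ_castSucc]

/-- Decomposition of `prOcc` along the last transition. -/
theorem prOcc_succ (a b : ℝ) (N m : ℕ) (c d : Bool) :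
    prOcc a b (N + 1) m c d = ∑ t : Fin (N + 1) → Bool,
      if t 0 = c ∧ (univ.filter fun n : Fin N => t n.castSucc = true).card +
          (if t (Fin.last N) = true then 1 else 0) = m
        then geTrajProb a b N t * geStep a b (t (Fin.last N)) d else 0 := by
  have h0 (t : Fin (N + 1) → Bool) (e : Bool) :
      (Fin.snoc t e : Fin (N + 2) → Bool) 0 = t 0 := by
    rw [← Fin.castSucc_zero, Fin.snoc_castSucc]
  unfold prOcc
  rw [← (Fin.snocEquiv fun _ : Fin (N + 2) => Bool).sum_comp, Fintype.sum_prod_type_right]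
  refine sum_congr rfl fun t _ => ?_
  have h1 (e : Bool) : Fin.snocEquiv (fun _ : Fin (N + 2) => Bool) (e, t) = Fin.snoc t e := rfl
  simp only [h1, geTrajProb_snoc, card_filter_snoc, h0, Fin.snoc_last]
  rw [Fintype.sum_eq_single d fun e he => if_neg fun h => he h.2.1]
  simp

theorem prOcc_succ_succ (a b : ℝ) (N m : ℕ) (c d : Bool) :
    prOcc a b (N + 1) (m + 1) c d =
      geStep a b true d * prOcc a b N m c true +
        geStep a b false d * prOcc a b N (m + 1) c false := by
  rw [prOcc_succ]
  unfold prOcc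
  rw [mul_sum, mul_sum, ← sum_add_distrib]
  refine sum_congr rfl fun t _ => ?_
  cases h : t (Fin.last N) <;> simp [mul_comm]

theorem prOcc_succ_zero (a b : ℝ) (N : ℕ) (c d : Bool) :
    prOcc a b (N + 1) 0 c d = geStep a b false d * prOcc a b N 0 c false := by
  rw [prOcc_succ]
  unfold prOcc
  rw [mul_sum]
  refine sum_congr rfl fun t _ => ?_
  cases h : t (Fin.last N) <;> simp [mul_comm]

theorem prOcc_eq_zero_of_lt (a b : ℝ) {N m : ℕ} (h : N < m) (c d : Bool) :
    prOcc a b N m c d = 0 := by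
  refine sum_eq_zero fun t _ => if_neg fun ht => ?_
  have := card_filter_le (univ : Finset (Fin N)) fun n => t n.castSucc = true
  rw [ht.2.2, card_univ, Fintype.card_fin] at this
  omega

theorem prOcc_zero_zero_self (a b : ℝ) (c : Bool) : prOcc a b 0 0 c c = 1 := by
  unfold prOcc
  rw [Fintype.sum_eq_single fun _ => c]
  · simp [geTrajProb]
  · refine fun t ht => if_neg fun h => ht (funext fun i => ?_)
    rw [Fin.fin_one_eq_zero i, h.1]

theorem prOcc_zero_of_ne (a b : ℝ) (m : ℕ) {c d : Bool} (h : c ≠ d) :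
    prOcc a b 0 m c d = 0 :=
  sum_eq_zero fun _ _ => if_neg fun ht => h (ht.1.symm.trans ht.2.1)

theorem prOcc_zero_true_false (a b : ℝ) (N : ℕ) : prOcc a b N 0 true false = 0 := by
  induction N with
  | zero => exact prOcc_zero_of_ne a b 0 (by decide)
  | succ N ih => rw [prOcc_succ_zero, ih, mul_zero]

theorem prOcc_succ_zero_true (a b : ℝ) (N : ℕ) (d : Bool) :
    prOcc a b (N + 1) 0 true d = 0 := by
  rw [prOcc_succ_zero, prOcc_zero_true_false, mul_zero]

theorem prOcc_self_true_true (a b : ℝ) (N : ℕ) : prOcc a b N N true true = (1 - a) ^ N := by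
  induction N with
  | zero => rw [prOcc_zero_zero_self, pow_zero]
  | succ N ih =>
    rw [prOcc_succ_succ, ih, prOcc_eq_zero_of_lt a b N.lt_succ_self]
    simp [geStep, pow_succ']

theorem hypF_zero_left (m : ℕ) (l : ℝ) : hypF 0 m l = 1 := by simp [hypF]

theorem hypF_zero_right (j : ℕ) (l : ℝ) : hypF j 0 l = 1 := by
  simp [hypF, sum_range_succ']

theorem hypF_succ_left_sub (j m : ℕ) (l : ℝ) :
    hypF (j + 1) m l - hypF j m l =
      ∑ k ∈ range (j + 1), (j.choose k : ℝ) * (m.choose (k + 1) : ℝ) * l ^ (k + 1) := by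
  have h : hypF j m l =
      ∑ k ∈ range (j + 2), (j.choose k : ℝ) * (m.choose k : ℝ) * l ^ k := by
    rw [sum_range_succ]
    simp [hypF]
  rw [h, hypF, ← sum_sub_distrib, sum_range_succ']
  simp only [Nat.choose_succ_succ, Nat.choose_zero_right, Nat.cast_add, sub_self, add_zero]
  exact sum_congr rfl fun k _ => by ring

theorem hypF_succ_succ (j m : ℕ) (l : ℝ) :
    hypF (j + 1) (m + 1) l - hypF j (m + 1) l =
      hypF (j + 1) m l - hypF j m l + l * hypF j m l := by
  rw [hypF_succ_left_sub, hypF_succ_left_sub, hypF, mul_sum, ← sum_add_distrib]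
  refine sum_congr rfl fun k _ => ?_
  rw [Nat.choose_succ_succ m k]
  push_cast
  ring

/-- Closed form ending in the bad state, given the one ending in the good state. -/
theorem prOcc_true_false_of_true_true {a b l : ℝ} (m : ℕ)
    (h : ∀ j, prOcc a b (m + (j + 1)) m true true =
      (1 - a) ^ m * (1 - b) ^ (j + 1) * (hypF (j + 1) m l - hypF j m l)) (j : ℕ) :
    prOcc a b (m + j + 1) (m + 1) true false =
      (1 - a) ^ m * (1 - b) ^ j * a * hypF j m l := by
  induction j with
  | zero =>
    rw [add_zero, prOcc_succ_succ, prOcc_self_true_true, prOcc_eq_zero_of_lt a b m.lt_succ_self,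
      hypF_zero_left]
    simp [geStep]
    ring
  | succ j ih =>
    rw [prOcc_succ_succ, h, ← add_assoc, ih]
    simp [geStep]
    ring

theorem prOcc_true_true {a b : ℝ} (ha : 1 - a ≠ 0) (hb : 1 - b ≠ 0) (m j : ℕ) :
    prOcc a b (m + (j + 1)) m true true = (1 - a) ^ m * (1 - b) ^ (j + 1) *
      (hypF (j + 1) m (a * b / ((1 - a) * (1 - b))) -
        hypF j m (a * b / ((1 - a) * (1 - b)))) := by
  induction m generalizing j with
  | zero => rw [zero_add, prOcc_succ_zero_true, hypF_zero_right, hypF_zero_right]; ring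
  | succ m ih =>
    rw [show m + 1 + (j + 1) = m + (j + 1) + 1 by ring, prOcc_succ_succ, ih, ← add_assoc,
      prOcc_true_false_of_true_true m ih, hypF_succ_succ]
    simp only [geStep, if_true, Bool.false_eq_true, if_false]
    field_simp
    ring

/-- joint distribution of the good-state occupation time `n_g` and the
final state, conditioned on starting in the good state `g`, for the two-state
Gilbert-Elliott Markov chain, in terms of hypergeometric functions, with
`λ = αβ/((1−α)(1−β))`. -/
theorem stmt_3 (N : ℕ) (hN : 1 ≤ N) (α β : ℝ)
    (hα : α ∈ Set.Ioo (0 : ℝ) 1) (hβ : β ∈ Set.Ioo (0 : ℝ) 1) :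
    (∀ m : ℕ, 0 < m → m < N →
      prOcc α β N m true true =
        (1 - α) ^ m * (1 - β) ^ (N - m) *
          (hypF (N - m) m (α * β / ((1 - α) * (1 - β))) -
            hypF (N - m - 1) m (α * β / ((1 - α) * (1 - β)))) ∧
      prOcc α β N m true false =
        (1 - α) ^ (m - 1) * (1 - β) ^ (N - m + 1) * (α / (1 - β)) *
          hypF (N - m) (m - 1) (α * β / ((1 - α) * (1 - β)))) ∧
    (∀ d : Bool, prOcc α β N 0 true d = 0) ∧
    prOcc α β N N true true = (1 - α) ^ N := by
  have ha : 1 - α ≠ 0 := (sub_pos.2 hα.2).ne'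
  have hb : 1 - β ≠ 0 := (sub_pos.2 hβ.2).ne'
  refine ⟨fun m hm hmN => ?_, fun d => ?_, prOcc_self_true_true α β N⟩
  · obtain ⟨m, rfl⟩ := Nat.exists_eq_succ_of_ne_zero hm.ne'
    obtain ⟨j, rfl⟩ := Nat.exists_eq_add_of_lt hmN
    have hj : m.succ + j + 1 - m.succ = j + 1 := by omega
    rw [hj, Nat.add_sub_cancel, Nat.succ_sub_one]
    refine ⟨prOcc_true_true ha hb (m + 1) j, ?_⟩
    rw [show m.succ + j + 1 = m + (j + 1) + 1 by omega,
      prOcc_true_false_of_true_true m (prOcc_true_true ha hb m)]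
    field_simp
    ring
  · obtain ⟨n, rfl⟩ := Nat.exists_eq_add_of_le' hN
    exact prOcc_succ_zero_true α β n d
end

section
/- Let α, β > 0 and let x ∈ [0,1]. Let (m_N) be a sequence of integers with 0 ≤ m_N ≤ N and m_N/N → x, and for N > max(α,β) set λ_N = (α/N)(β/N) / ((1 − α/N)(1 − β/N)). Then lim_{N→∞} ∑_{k≥0} C(m_N, k) · C(N − m_N − 1, k) · λ_N^k = ∑_{k=0}^∞ (αβ x(1−x))^k / (k!)^2; that is, the terminating hypergeometric sum F(−N+m_N+1, −m_N; 1; λ_N) converges to I_0(2√(αβx(1−x))), the modified Bessel function of order 0. -/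
open scoped Classical
open Finset Filter

/-- Subtracting a constant (with truncation) does not change the growth rate of a sequence. -/
theorem tendsto_natCast_sub_const_div {a : ℕ → ℕ} {y : ℝ}
    (ha : Tendsto (fun N : ℕ => (a N : ℝ) / N) atTop (nhds y)) (k : ℕ) :
    Tendsto (fun N : ℕ => ((a N - k : ℕ) : ℝ) / N) atTop (nhds y) := by
  have hk : Tendsto (fun N : ℕ => (a N : ℝ) / N - (k : ℝ) / N) atTop (nhds y) := by
    simpa using ha.sub (tendsto_const_div_atTop_nhds_zero_nat (k : ℝ))
  refine tendsto_of_tendsto_of_tendsto_of_le_of_le hk ha (fun N => ?_) (fun N => ?_)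
  · have h : (a N : ℝ) ≤ ((a N - k : ℕ) : ℝ) + k := by
      exact_mod_cast (by omega : a N ≤ a N - k + k)
    simp only [← sub_div]
    gcongr
    linarith
  · dsimp only
    gcongr
    omega

theorem tendsto_choose_div_pow {a : ℕ → ℕ} {y : ℝ}
    (ha : Tendsto (fun N : ℕ => (a N : ℝ) / N) atTop (nhds y)) (k : ℕ) :
    Tendsto (fun N : ℕ => ((a N).choose k : ℝ) / (N : ℝ) ^ k) atTop
      (nhds (y ^ k / (k.factorial : ℝ))) := by
  have hdesc : Tendsto (fun N : ℕ => ((a N).descFactorial k : ℝ) / (N : ℝ) ^ k) atTop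
      (nhds (y ^ k)) := by
    induction k with
    | zero => simp
    | succ k ih =>
      rw [pow_succ']
      refine ((tendsto_natCast_sub_const_div ha k).mul ih).congr fun N => ?_
      rw [Nat.descFactorial_succ, Nat.cast_mul, pow_succ', div_mul_div_comm]
  refine (hdesc.div_const (k.factorial : ℝ)).congr fun N => ?_
  have hk : (k.factorial : ℝ) ≠ 0 := by positivity
  rw [Nat.descFactorial_eq_factorial_mul_choose, Nat.cast_mul]
  field_simp

theorem choose_div_pow_le {a N : ℕ} (h : a ≤ N) (k : ℕ) :
    (a.choose k : ℝ) / (N : ℝ) ^ k ≤ 1 / (k.factorial : ℝ) := by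
  refine div_le_of_le_mul₀ (by positivity) (by positivity) ?_
  calc (a.choose k : ℝ) ≤ (a : ℝ) ^ k / (k.factorial : ℝ) := Nat.choose_le_pow_div k a
    _ ≤ (N : ℝ) ^ k / (k.factorial : ℝ) := by gcongr
    _ = 1 / (k.factorial : ℝ) * (N : ℝ) ^ k := by ring

/-- Dominated convergence for terminating Gauss hypergeometric sums whose argument is of order
`1 / N ^ 2`. -/
theorem tendsto_sum_choose_mul_choose_mul_pow {a b : ℕ → ℕ} {l : ℕ → ℝ} {y z c : ℝ}
    (haN : ∀ N, a N ≤ N) (hbN : ∀ N, b N ≤ N)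
    (ha : Tendsto (fun N : ℕ => (a N : ℝ) / N) atTop (nhds y))
    (hb : Tendsto (fun N : ℕ => (b N : ℝ) / N) atTop (nhds z))
    (hl : Tendsto (fun N : ℕ => (N : ℝ) ^ 2 * l N) atTop (nhds c)) :
    Tendsto (fun N : ℕ => ∑ k ∈ Finset.range (N + 1),
        ((a N).choose k : ℝ) * ((b N).choose k : ℝ) * l N ^ k) atTop
      (nhds (∑' k : ℕ, (c * y * z) ^ k / (k.factorial : ℝ) ^ 2)) := by
  have hterm : ∀ N : ℕ, 0 < N → ∀ k : ℕ,
      ((a N).choose k : ℝ) / (N : ℝ) ^ k * (((b N).choose k : ℝ) / (N : ℝ) ^ k) *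
        ((N : ℝ) ^ 2 * l N) ^ k =
      ((a N).choose k : ℝ) * ((b N).choose k : ℝ) * l N ^ k := by
    intro N hN k
    have : (N : ℝ) ≠ 0 := by positivity
    rw [mul_pow, pow_right_comm]
    field_simp
  have hsum : ∀ N : ℕ, ∑' k : ℕ, ((a N).choose k : ℝ) * ((b N).choose k : ℝ) * l N ^ k =
      ∑ k ∈ Finset.range (N + 1), ((a N).choose k : ℝ) * ((b N).choose k : ℝ) * l N ^ k := by
    intro N
    refine tsum_eq_sum fun k hk => ?_
    have hk : a N < k := by
      have := haN N
      simp only [Finset.mem_range, not_lt] at hk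
      omega
    simp [Nat.choose_eq_zero_of_lt hk]
  refine Tendsto.congr hsum ?_
  refine tendsto_tsum_of_dominated_convergence
    (bound := fun k : ℕ => (|c| + 1) ^ k / (k.factorial : ℝ))
    (Real.summable_pow_div_factorial _) (fun k => ?_) ?_
  · have h := ((tendsto_choose_div_pow ha k).mul (tendsto_choose_div_pow hb k)).mul (hl.pow k)
    have hlim : y ^ k / (k.factorial : ℝ) * (z ^ k / (k.factorial : ℝ)) * c ^ k =
        (c * y * z) ^ k / (k.factorial : ℝ) ^ 2 := by
      ring
    rw [hlim] at h
    refine h.congr' ?_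
    filter_upwards [eventually_gt_atTop 0] with N hN using hterm N hN k
  · filter_upwards [eventually_gt_atTop 0,
      hl.abs.eventually_le_const (lt_add_one |c|)] with N hN hlN k
    rw [← hterm N hN k, norm_mul, norm_pow, Real.norm_eq_abs ((N : ℝ) ^ 2 * l N),
      Real.norm_of_nonneg (by positivity)]
    have hfact : (1 : ℝ) / (k.factorial : ℝ) ≤ 1 := by
      rw [div_le_one (by positivity)]
      exact_mod_cast k.factorial_pos
    calc _ ≤ 1 / (k.factorial : ℝ) * 1 * (|c| + 1) ^ k := by
          refine mul_le_mul (mul_le_mul (choose_div_pow_le (haN N) k)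
            ((choose_div_pow_le (hbN N) k).trans hfact) (by positivity) (by positivity)) ?_
            (by positivity) (by positivity)
          gcongr
      _ = (|c| + 1) ^ k / (k.factorial : ℝ) := by ring

/-- with `λ_N = (α/N)(β/N)/((1−α/N)(1−β/N))` and `m_N/N → x ∈ [0,1]`,
the terminating hypergeometric sum
`F(−N+m_N+1, −m_N; 1; λ_N) = ∑_{k≥0} C(m_N,k) C(N−m_N−1,k) λ_N^k`
converges to `∑_k (αβx(1−x))^k/(k!)² = I_0(2√(αβx(1−x)))`, the modified Bessel
function of order 0.  (The finite sum over `k ∈ {0,…,N}` contains all nonzero terms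
since `C(m_N,k) = 0` for `k > m_N`.) -/
theorem stmt_9 (α β x : ℝ) (hα : 0 < α) (hβ : 0 < β) (hx : x ∈ Set.Icc (0 : ℝ) 1)
    (m : ℕ → ℕ) (hm : ∀ N, m N ≤ N)
    (hmx : Tendsto (fun N : ℕ => (m N : ℝ) / N) atTop (nhds x)) :
    Tendsto (fun N : ℕ => ∑ k ∈ Finset.range (N + 1),
        ((m N).choose k : ℝ) * ((N - m N - 1).choose k : ℝ) *
          ((α / N) * (β / N) / ((1 - α / N) * (1 - β / N))) ^ k) atTop
      (nhds (∑' k : ℕ, (α * β * x * (1 - x)) ^ k / (k.factorial : ℝ) ^ 2)) := by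
  have hc : Tendsto (fun N : ℕ => ((N - m N : ℕ) : ℝ) / N) atTop (nhds (1 - x)) := by
    refine (hmx.const_sub 1).congr' ?_
    filter_upwards [eventually_gt_atTop 0] with N hN
    have : (N : ℝ) ≠ 0 := by positivity
    rw [Nat.cast_sub (hm N), sub_div, div_self this]
  have hl : Tendsto (fun N : ℕ => (N : ℝ) ^ 2 *
      ((α / N) * (β / N) / ((1 - α / N) * (1 - β / N)))) atTop (nhds (α * β)) := by
    have hα' := (tendsto_const_div_atTop_nhds_zero_nat α).const_sub 1
    have hβ' := (tendsto_const_div_atTop_nhds_zero_nat β).const_sub 1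
    have h := (tendsto_const_nhds (x := α * β)).div (hα'.mul hβ') (by norm_num)
    simp only [sub_zero, mul_one, div_one] at h
    refine h.congr' ?_
    filter_upwards [eventually_gt_atTop 0] with N hN
    have hN' : (N : ℝ) ≠ 0 := by positivity
    rw [Pi.div_apply, ← mul_div_assoc]
    congr 1
    field_simp
  exact tendsto_sum_choose_mul_choose_mul_pow hm (fun N => (Nat.sub_le _ _).trans (Nat.sub_le _ _)) hmx
    (tendsto_natCast_sub_const_div hc 1) hl
end

section
/- For every ρ ∈ [0,1] and every M ≥ 2, the probability of maximum-likelihood decoding failure (with ties counted as errors) satisfies P_e ≤ (M−1)^ρ ∑_{y ∈ Y^N} [∑_{x ∈ X^N} Q_N(x) P_N(y|x)^{1/(1+ρ)}]^{1+ρ}. -/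
open scoped Classical
open Finset

/-- A sum over `(m + 1)`-tuples splits into the head and the tail. -/
theorem sum_fin_succ_tuple {α : Type*} [Fintype α] {m : ℕ} (F : (Fin (m + 1) → α) → ℝ) :
    ∑ c, F c = ∑ x, ∑ c : Fin m → α, F (Fin.cons x c) := by
  rw [← (Fin.consEquiv fun _ => α).sum_comp, Fintype.sum_prod_type]
  rfl

theorem sum_prod_tuple_eq_one {α : Type*} [Fintype α] {Q : α → ℝ} (hQ1 : ∑ x, Q x = 1) (m : ℕ) :
    ∑ c : Fin m → α, ∏ i, Q (c i) = 1 := by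
  rw [← Fintype.sum_pow, hQ1, one_pow]

/-- The union bound for `m` independent samples from `Q`. -/
theorem sum_prod_exists_le {α : Type*} [Fintype α] {Q : α → ℝ} (hQ0 : ∀ x, 0 ≤ Q x)
    (hQ1 : ∑ x, Q x = 1) (A : α → Prop) (m : ℕ) :
    ∑ c : Fin m → α, (∏ i, Q (c i)) * (if ∃ i, A (c i) then 1 else 0)
      ≤ m * ∑ x, Q x * (if A x then 1 else 0) := by
  induction m with
  | zero => simp
  | succ m ih =>
    have key : ∀ (x : α) (c : Fin m → α),
        Q x * (∏ i, Q (c i)) * (if A x ∨ ∃ i, A (c i) then (1 : ℝ) else 0)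
          ≤ Q x * (if A x then 1 else 0) * (∏ i, Q (c i))
            + Q x * ((∏ i, Q (c i)) * (if ∃ i, A (c i) then 1 else 0)) := by
      intro x c
      have h0 : 0 ≤ Q x * ∏ i, Q (c i) := mul_nonneg (hQ0 x) (prod_nonneg fun i _ => hQ0 _)
      by_cases h1 : A x <;> by_cases h2 : ∃ i, A (c i) <;> simp only [h1, h2, or_true, or_false,
        if_true, if_false] <;> linarith
    rw [sum_fin_succ_tuple]
    simp only [Fin.prod_univ_succ, Fin.exists_fin_succ, Fin.cons_zero, Fin.cons_succ]
    refine (sum_le_sum fun x _ => sum_le_sum fun c _ => key x c).trans ?_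
    simp only [sum_add_distrib, ← mul_sum, ← sum_mul]
    rw [sum_prod_tuple_eq_one hQ1, hQ1]
    push_cast
    linarith

theorem sum_prod_exists_le_one {α : Type*} [Fintype α] {Q : α → ℝ} (hQ0 : ∀ x, 0 ≤ Q x)
    (hQ1 : ∑ x, Q x = 1) (A : α → Prop) (m : ℕ) :
    ∑ c : Fin m → α, (∏ i, Q (c i)) * (if ∃ i, A (c i) then 1 else 0) ≤ 1 := by
  refine le_of_le_of_eq ?_ (sum_prod_tuple_eq_one hQ1 m)
  refine sum_le_sum fun c _ => mul_le_of_le_one_right (prod_nonneg fun i _ => hQ0 _) ?_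
  split_ifs <;> norm_num

/-- Gallager's `ρ`-trick: a number below both `1` and `t` is below `t ^ ρ`. -/
theorem le_rpow_of_le_one_of_le {a t ρ : ℝ} (ha : 0 ≤ a) (h1 : a ≤ 1) (ht : a ≤ t)
    (hρ0 : 0 ≤ ρ) (hρ1 : ρ ≤ 1) : a ≤ t ^ ρ :=
  (Real.self_le_rpow_of_le_one ha h1 hρ1).trans (Real.rpow_le_rpow ha ht hρ0)

/-- Markov's inequality for `p ^ s`. -/
theorem sum_mul_ite_le_div {α : Type*} [Fintype α] {Q p : α → ℝ} (hQ0 : ∀ x, 0 ≤ Q x)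
    (hp0 : ∀ x, 0 ≤ p x) {a s : ℝ} (ha : 0 < a) (hs : 0 ≤ s) :
    ∑ x, Q x * (if a ≤ p x then 1 else 0) ≤ (∑ x, Q x * p x ^ s) / a ^ s := by
  have has : 0 < a ^ s := Real.rpow_pos_of_pos ha s
  rw [sum_div]
  refine sum_le_sum fun x _ => ?_
  rw [mul_div_assoc]
  refine mul_le_mul_of_nonneg_left ?_ (hQ0 x)
  split_ifs with h
  · rw [one_le_div has]
    exact Real.rpow_le_rpow ha.le h hs
  · exact div_nonneg (Real.rpow_nonneg (hp0 x) s) has.le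

/-- The random-coding bound for one channel output, with likelihood function `p`. -/
theorem sum_likelihood_failure_le {α : Type*} [Fintype α] {Q p : α → ℝ} (hQ0 : ∀ x, 0 ≤ Q x)
    (hQ1 : ∑ x, Q x = 1) (hp0 : ∀ x, 0 ≤ p x) (m : ℕ) {ρ : ℝ} (hρ0 : 0 ≤ ρ) (hρ1 : ρ ≤ 1) :
    ∑ x, Q x * p x * ∑ c : Fin m → α, (∏ i, Q (c i)) * (if ∃ i, p x ≤ p (c i) then 1 else 0)
      ≤ (m : ℝ) ^ ρ * (∑ x, Q x * p x ^ (1 / (1 + ρ))) ^ (1 + ρ) := by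
  set s := 1 / (1 + ρ) with hs
  set S := ∑ x, Q x * p x ^ s with hS
  have hρ : 0 < 1 + ρ := by linarith
  have hs0 : 0 < s := by positivity
  have hS0 : 0 ≤ S := sum_nonneg fun x _ => mul_nonneg (hQ0 x) (Real.rpow_nonneg (hp0 x) s)
  have hexp : 1 - s * ρ = s := by rw [hs]; field_simp; ring
  have hSpow : S ^ (1 + ρ) = S * S ^ ρ := by
    rw [Real.rpow_add_of_nonneg hS0 zero_le_one hρ0, Real.rpow_one]
  have hterm : ∀ x, Q x * p x *
      ∑ c : Fin m → α, (∏ i, Q (c i)) * (if ∃ i, p x ≤ p (c i) then (1 : ℝ) else 0)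
      ≤ Q x * p x ^ s * ((m : ℝ) ^ ρ * S ^ ρ) := by
    intro x
    rcases (hp0 x).eq_or_lt with h | h
    · rw [← h, Real.zero_rpow hs0.ne']
      simp
    have hfail := le_rpow_of_le_one_of_le
      (sum_nonneg fun c _ => mul_nonneg (prod_nonneg fun i _ => hQ0 _)
        (by split_ifs <;> norm_num))
      (sum_prod_exists_le_one hQ0 hQ1 (fun x' => p x ≤ p x') m)
      ((sum_prod_exists_le hQ0 hQ1 (fun x' => p x ≤ p x') m).trans
        (mul_le_mul_of_nonneg_left (sum_mul_ite_le_div hQ0 hp0 h hs0.le) m.cast_nonneg))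
      hρ0 hρ1
    refine (mul_le_mul_of_nonneg_left hfail (mul_nonneg (hQ0 x) h.le)).trans_eq ?_
    have hpow : p x ^ s = p x / p x ^ (s * ρ) := by
      rw [← Real.rpow_one_sub' h.le (by rw [hexp]; exact hs0.ne'), hexp]
    rw [Real.mul_rpow m.cast_nonneg (div_nonneg hS0 (Real.rpow_nonneg h.le s)),
      Real.div_rpow hS0 (Real.rpow_nonneg h.le s), ← Real.rpow_mul h.le, hpow]
    ring
  refine (sum_le_sum fun x _ => hterm x).trans_eq ?_
  rw [← sum_mul, ← hS, hSpow]
  ring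

/-- Gallager's random-coding bound (Theorem 5.6.1 of Gallager) for an
arbitrary discrete channel `P_N` on length-`N` blocks and an arbitrary codeword
distribution `Q_N`: for every `ρ ∈ [0,1]`, the probability of maximum-likelihood
decoding failure (ties counted as errors) for a random code with `M` independent
codewords, message `0` being sent, is at most
`(M-1)^ρ ∑_y [∑_x Q_N(x) P_N(y|x)^{1/(1+ρ)}]^{1+ρ}`. -/
theorem stmt_11 {X Y : Type*} [Fintype X] [Fintype Y]
    (N M : ℕ) (hN : 1 ≤ N) (hM : 2 ≤ M)
    (QN : (Fin N → X) → ℝ) (hQ0 : ∀ x, 0 ≤ QN x) (hQ1 : ∑ x, QN x = 1)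
    (PN : (Fin N → Y) → (Fin N → X) → ℝ) (hP0 : ∀ y x, 0 ≤ PN y x)
    (hP1 : ∀ x, ∑ y, PN y x = 1)
    (ρ : ℝ) (hρ0 : 0 ≤ ρ) (hρ1 : ρ ≤ 1) :
    (∑ cb : Fin M → Fin N → X, ∑ y : Fin N → Y,
        (∏ i, QN (cb i)) * PN y (cb ⟨0, by omega⟩) *
          (if ∃ i : Fin M, i ≠ ⟨0, by omega⟩ ∧ PN y (cb ⟨0, by omega⟩) ≤ PN y (cb i)
            then 1 else 0))
      ≤ ((M : ℝ) - 1) ^ ρ *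
          ∑ y : Fin N → Y, (∑ x : Fin N → X, QN x * PN y x ^ (1 / (1 + ρ))) ^ (1 + ρ) := by
  obtain ⟨m, rfl⟩ : ∃ m, M = m + 1 := ⟨M - 1, by omega⟩
  rw [sum_comm, mul_sum]
  refine sum_le_sum fun y _ => ?_
  have hM1 : ((m + 1 : ℕ) : ℝ) - 1 = m := by push_cast; ring
  rw [hM1]
  refine le_of_eq_of_le ?_ (sum_likelihood_failure_le hQ0 hQ1 (hP0 y) m hρ0 hρ1)
  rw [sum_fin_succ_tuple]
  refine sum_congr rfl fun x _ => ?_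
  rw [mul_sum]
  refine sum_congr rfl fun c _ => ?_
  simp only [Fin.mk_zero', Fin.prod_univ_succ, Fin.exists_fin_succ, Fin.cons_zero, Fin.cons_succ,
    ne_eq, not_true_eq_false, false_and, false_or, Fin.succ_ne_zero, not_false_eq_true, true_and]
  ring
end

section
/- The probability of minimum-distance decoding failure (with ties counted as errors) equals ∑_{τ=0}^{N} C(N,τ) p^τ (1−p)^{N−τ} [1 − (1 − 2^{−N} ∑_{j=0}^{τ} C(N,j))^{M−1}]. -/
open scoped Classical
open Finset

/-- Hamming weight of a binary word. -/
def wt {N : ℕ} (z : Fin N → Bool) : ℕ :=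
  (Finset.univ.filter fun n => z n = true).card

/-- Hamming distance between two binary words. -/
def dH {N : ℕ} (x y : Fin N → Bool) : ℕ :=
  (Finset.univ.filter fun n => x n ≠ y n).card

/-- A sum over binary words of a function of the weight, grouped by weight. -/
theorem sum_apply_wt {N : ℕ} (g : ℕ → ℝ) :
    ∑ z : Fin N → Bool, g (wt z) = ∑ τ ∈ Finset.range (N + 1), (N.choose τ : ℝ) * g τ := by
  have h := Finset.sum_powerset_apply_card g (x := (Finset.univ : Finset (Fin N)))
  simp only [Finset.powerset_univ, Finset.card_univ, Fintype.card_fin, nsmul_eq_mul] at h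
  rw [← h]
  refine Finset.sum_bij' (fun z _ => Finset.univ.filter fun n => z n = true)
    (fun s _ n => decide (n ∈ s)) ?_ ?_ ?_ ?_ ?_ <;> intros <;> simp [wt]

theorem wt_le {N : ℕ} (z : Fin N → Bool) : wt z ≤ N :=
  (Finset.card_le_univ _).trans_eq (Fintype.card_fin N)

/-- The distance is the weight of the sum. -/
theorem dH_eq_wt_xor {N : ℕ} (x y : Fin N → Bool) : dH x y = wt fun n => xor (x n) (y n) := by
  simp [dH, wt]

theorem dH_xor_self {N : ℕ} (x z : Fin N → Bool) : dH x (fun n => xor (x n) (z n)) = wt z := by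
  simp [dH_eq_wt_xor]

/-- The cardinality of a Hamming ball. -/
theorem card_dH_le {N : ℕ} (y : Fin N → Bool) {τ : ℕ} (hτ : τ ≤ N) :
    ((Finset.univ.filter fun c => dH c y ≤ τ).card : ℝ) =
      ∑ j ∈ Finset.range (τ + 1), (N.choose j : ℝ) := by
  have hinv : Function.Involutive fun (c : Fin N → Bool) n => xor (c n) (y n) := fun c => by
    ext n; simp
  have h := sum_apply_wt (N := N) fun k => if k ≤ τ then 1 else 0
  rw [← Equiv.sum_comp hinv.toPerm] at h
  rw [Finset.card_filter]
  push_cast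
  simp only [dH_eq_wt_xor]
  refine h.trans ?_
  simp only [mul_ite, mul_one, mul_zero]
  rw [← Finset.sum_filter]
  refine Finset.sum_congr ?_ fun _ _ => rfl
  ext j
  simp only [Finset.mem_filter, Finset.mem_range]
  omega

/-- The number of `m`-tuples having at least one entry that satisfies `P`. -/
theorem sum_ite_exists {α : Type*} [Fintype α] (m : ℕ) (P : α → Prop) [DecidablePred P]
    [∀ f : Fin m → α, Decidable (∃ i, P (f i))] :
    (∑ f : Fin m → α, if ∃ i, P (f i) then (1 : ℝ) else 0) =
      (Fintype.card α : ℝ) ^ m -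
        ((Fintype.card α : ℝ) - ((Finset.univ.filter P).card : ℝ)) ^ m := by
  have hcompl : ((Finset.univ.filter fun a => ¬ P a).card : ℝ) =
      Fintype.card α - (Finset.univ.filter P).card := by
    rw [eq_sub_iff_add_eq', ← Nat.cast_add, Finset.card_filter_add_card_filter_not,
      Finset.card_univ]
  have hall : (∑ f : Fin m → α, if ∀ i, ¬ P (f i) then (1 : ℝ) else 0) =
      ((Finset.univ.filter fun a => ¬ P a).card : ℝ) ^ m := by
    have hpi : (Finset.univ.filter fun f : Fin m → α => ∀ i, ¬ P (f i)) =
        Fintype.piFinset fun _ => Finset.univ.filter fun a => ¬ P a := by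
      ext f; simp
    rw [← Nat.cast_pow, ← Fintype.card_piFinset_const, ← hpi, Finset.card_filter]
    push_cast
    rfl
  have hsum : (∑ f : Fin m → α, if ∃ i, P (f i) then (1 : ℝ) else 0) =
      ∑ f : Fin m → α, (1 - if ∀ i, ¬ P (f i) then (1 : ℝ) else 0) := by
    refine Finset.sum_congr rfl fun f _ => ?_
    by_cases hf : ∃ i, P (f i)
    · rw [if_pos hf, if_neg fun h => hf.elim h, sub_zero]
    · rw [if_neg hf, if_pos (not_exists.mp hf), sub_self]
  rw [hsum, Finset.sum_sub_distrib, hall, hcompl]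
  simp

/-- The number of `m`-tuples of words having an entry within distance `τ` of `y`. -/
theorem sum_ite_exists_dH_le {N : ℕ} (m : ℕ) (y : Fin N → Bool) {τ : ℕ} (hτ : τ ≤ N) :
    (∑ cs : Fin m → Fin N → Bool, if ∃ i, dH (cs i) y ≤ τ then (1 : ℝ) else 0) =
      (2 ^ N) ^ m *
        (1 - (1 - (∑ j ∈ Finset.range (τ + 1), (N.choose j : ℝ)) / 2 ^ N) ^ m) := by
  rw [sum_ite_exists m fun c => dH c y ≤ τ, card_dH_le y hτ, mul_sub, ← mul_pow, mul_sub,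
    mul_div_cancel₀ _ (by positivity)]
  simp

/-- Fano: for random coding over BSC(p) with `M` independent uniform
codewords, message `0` sent, output `Y = C_0 ⊕ Z` with `Z` i.i.d. Bernoulli(p), the
probability of minimum-distance decoding failure (ties counted as errors, i.e. the
event that `d_H(C_i, Y) ≤ d_H(C_0, Y)` for some `i ≠ 0`) equals
`∑_{τ=0}^N C(N,τ) p^τ (1−p)^{N−τ} [1 − (1 − 2^{−N} ∑_{j=0}^τ C(N,j))^{M−1}]`. -/
theorem stmt_15 (N M : ℕ) (hN : 1 ≤ N) (hM : 2 ≤ M) (p : ℝ)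
    (hp : p ∈ Set.Ioo (0 : ℝ) 1) :
    (∑ cb : Fin M → Fin N → Bool, ∑ z : Fin N → Bool,
        (1 / 2 ^ (N * M) : ℝ) * p ^ wt z * (1 - p) ^ (N - wt z) *
          (if ∃ i : Fin M, i ≠ ⟨0, by omega⟩ ∧
              dH (cb i) (fun n => xor (cb ⟨0, by omega⟩ n) (z n)) ≤
                dH (cb ⟨0, by omega⟩) (fun n => xor (cb ⟨0, by omega⟩ n) (z n))
            then 1 else 0))
      = ∑ τ ∈ Finset.range (N + 1), (N.choose τ : ℝ) * p ^ τ * (1 - p) ^ (N - τ) *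
          (1 - (1 - (∑ j ∈ Finset.range (τ + 1), (N.choose j : ℝ)) / 2 ^ N) ^ (M - 1)) := by
  obtain ⟨m, rfl⟩ : ∃ m, M = m + 1 := ⟨M - 1, by omega⟩
  have hzero : (⟨0, by omega⟩ : Fin (m + 1)) = 0 := rfl
  simp only [hzero, dH_xor_self, Nat.add_sub_cancel]
  rw [← Equiv.sum_comp (Fin.consEquiv fun _ : Fin (m + 1) => Fin N → Bool),
    Fintype.sum_prod_type]
  simp only [Fin.consEquiv_apply, Fin.cons_zero, Fin.exists_fin_succ, Fin.cons_succ, ne_eq,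
    not_true_eq_false, false_and, false_or, Fin.succ_ne_zero, not_false_eq_true, true_and]
  have hinner (c : Fin N → Bool) :
      (∑ cs : Fin m → Fin N → Bool, ∑ z : Fin N → Bool,
        (1 / 2 ^ (N * (m + 1)) : ℝ) * p ^ wt z * (1 - p) ^ (N - wt z) *
          (if ∃ i, dH (cs i) (fun n => xor (c n) (z n)) ≤ wt z then 1 else 0)) =
      1 / 2 ^ N * ∑ τ ∈ Finset.range (N + 1), (N.choose τ : ℝ) * (p ^ τ * (1 - p) ^ (N - τ) *
          (1 - (1 - (∑ j ∈ Finset.range (τ + 1), (N.choose j : ℝ)) / 2 ^ N) ^ m)) := by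
    rw [Finset.sum_comm, ← sum_apply_wt fun τ => p ^ τ * (1 - p) ^ (N - τ) *
      (1 - (1 - (∑ j ∈ Finset.range (τ + 1), (N.choose j : ℝ)) / 2 ^ N) ^ m), Finset.mul_sum]
    refine Finset.sum_congr rfl fun z _ => ?_
    rw [← Finset.mul_sum, sum_ite_exists_dH_le m _ (wt_le z), pow_mul, pow_succ]
    field_simp
  rw [Finset.sum_congr rfl fun c _ => hinner c, Finset.sum_const, Finset.card_univ]
  simp [mul_assoc]
end
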